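/- Let p ≥ 4 and c ≥ 2, and let C = {1, 2c}. For every n ≥ p, if v ∈ N(n, p, C) then v XOR 1 ∈ N(n+1, p, C). -/

import Mathlib

/-- The minimum excludant of a set of naturals. -/
noncomputable def mex (S : Set ℕ) : ℕ := sInf {v | v ∉ S}

/-- Fueled auxiliary for the Grundy sequence of CUT with cut-set `C`. -/
noncomputable def cutGAux (C : Finset ℕ) : ℕ → ℕ → ℕ
  | 0, _ => 0
  | fuel + 1, n =>
      mex {v | ∃ d ∈ C, ∃ l : List ℕ, l.length = d + 1 ∧ (∀ x ∈ l, 0 < x) ∧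
            l.sum = n ∧ (l.map (cutGAux C fuel)).foldr (· ^^^ ·) 0 = v}

/-- The Grundy (nim-value) sequence of the game CUT with cut-set `C`. -/
noncomputable def cutG (C : Finset ℕ) (n : ℕ) : ℕ := cutGAux C n n

/-- The nim-value of an option (a tuple of pile sizes). -/
noncomputable def nimVal (C : Finset ℕ) (l : List ℕ) : ℕ :=
  (l.map (cutG C)).foldr (· ^^^ ·) 0

/-- The nim-set `N(n, p, C)`. -/
def nimSet (n p : ℕ) (C : Finset ℕ) : Set ℕ :=
  {v | ∃ l : List ℕ, l.length = p ∧ (∀ x ∈ l, 0 < x) ∧ l.sum = n ∧ nimVal C l = v}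

/-- The nim-value at offset `i` of block `b < 6`, each block having length `2 * c`. -/
def lowNim (b i : ℕ) : ℕ :=
  if b = 2 then (if i = 0 then 1 else 4 + (i + 1) % 2)
  else if b = 3 then 3 - i % 2
  else (if b = 0 then 0 else if b = 1 then 2 else if b = 4 then 4 else 6) + i % 2

/-- The Grundy value of a heap of size `m + 1` in CUT with cut-set `{1, 2 * c}`: it is
arithmetic-periodic with period `12 * c` and saltus `8`. -/
def cutNim (c m : ℕ) : ℕ :=
  8 * (m / (12 * c)) + lowNim (m % (12 * c) / (2 * c)) (m % (2 * c))

theorem lowNim_lt (b i : ℕ) : lowNim b i < 8 := by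
  unfold lowNim; split_ifs <;> omega

/-- A representative in `{0, 1, 2}` of the offset `i`, on which `lowNim` takes the same value. -/
def offRep (i : ℕ) : ℕ := if i = 0 then 0 else 2 - i % 2

theorem offRep_lt (i : ℕ) : offRep i < 3 := by unfold offRep; split_ifs <;> omega
theorem offRep_mod (i : ℕ) : offRep i % 2 = i % 2 := by unfold offRep; split_ifs <;> omega
theorem offRep_eq_zero (i : ℕ) : offRep i = 0 ↔ i = 0 := by
  unfold offRep; split_ifs <;> omega

theorem lowNim_offRep (b i : ℕ) : lowNim b (offRep i) = lowNim b i := by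
  have h := offRep_mod i
  have h0 := offRep_eq_zero i
  have h1 : (offRep i + 1) % 2 = (i + 1) % 2 := by omega
  simp only [lowNim, h, h0, h1]

theorem xor_eight_mul_add {k l k' l' : ℕ} (h : l < 8) (h' : l' < 8) :
    (8 * k + l) ^^^ (8 * k' + l') = 8 * (k ^^^ k') + (l ^^^ l') := by
  have hd := @Nat.xor_div_two_pow (8 * k + l) (8 * k' + l') 3
  have hm := @Nat.xor_mod_two_pow (8 * k + l) (8 * k' + l') 3
  have e1 : (8 * k + l) / 2 ^ 3 = k := by omega
  have e2 : (8 * k' + l') / 2 ^ 3 = k' := by omega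
  have e3 : (8 * k + l) % 2 ^ 3 = l := by omega
  have e4 : (8 * k' + l') % 2 ^ 3 = l' := by omega
  rw [e1, e2] at hd
  rw [e3, e4] at hm
  omega

theorem xor_lt_eight {a b : ℕ} (ha : a < 8) (hb : b < 8) : a ^^^ b < 8 :=
  Nat.xor_lt_two_pow (n := 3) ha hb

theorem exists_add_eq_xor_add_two_mul (a b : ℕ) : ∃ t, a + b = (a ^^^ b) + 2 * t := by
  induction a using Nat.strong_induction_on generalizing b with
  | _ a ih =>
    rcases Nat.eq_zero_or_pos a with rfl | ha
    · exact ⟨0, by simp⟩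
    obtain ⟨t, ht⟩ := ih (a / 2) (by omega) (b / 2)
    have hd : (a ^^^ b) / 2 = a / 2 ^^^ b / 2 := Nat.xor_div_two_pow (n := 1)
    have hm : (a ^^^ b) % 2 = (a + b) % 2 := by
      exact Nat.xor_mod_two_eq
    exact ⟨(a + b - (a ^^^ b)) / 2, by omega⟩

theorem cutNim_eq {c : ℕ} (hc : 0 < c) {k b i : ℕ} (hb : b < 6) (hi : i < 2 * c) :
    cutNim c (12 * (c * k) + 2 * (c * b) + i) = 8 * k + lowNim b i := by
  have hlt : 2 * (c * b) + i < 12 * c := by nlinarith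
  have e0 : 12 * (c * k) + 2 * (c * b) + i = (2 * (c * b) + i) + 12 * c * k := by ring
  have e1 : (12 * (c * k) + 2 * (c * b) + i) / (12 * c) = k := by
    rw [e0, Nat.add_mul_div_left _ _ (by omega), Nat.div_eq_of_lt hlt, zero_add]
  have e2 : (12 * (c * k) + 2 * (c * b) + i) % (12 * c) = 2 * (c * b) + i := by
    rw [e0, Nat.add_mul_mod_self_left, Nat.mod_eq_of_lt hlt]
  have e3 : (2 * (c * b) + i) / (2 * c) = b := by
    rw [show 2 * (c * b) + i = i + 2 * c * b by ring, Nat.add_mul_div_left _ _ (by omega),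
      Nat.div_eq_of_lt hi, zero_add]
  have e4 : (12 * (c * k) + 2 * (c * b) + i) % (2 * c) = i := by
    rw [show 12 * (c * k) + 2 * (c * b) + i = i + 2 * c * (6 * k + b) by ring,
      Nat.add_mul_mod_self_left, Nat.mod_eq_of_lt hi]
  rw [cutNim, e1, e2, e3, e4]

theorem exists_block {c : ℕ} (hc : 0 < c) (m : ℕ) :
    ∃ k b i, b < 6 ∧ i < 2 * c ∧ m = 12 * (c * k) + 2 * (c * b) + i ∧
      cutNim c m = 8 * k + lowNim b i := by
  have h1 := Nat.div_add_mod m (12 * c)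
  have h2 := Nat.div_add_mod (m % (12 * c)) (2 * c)
  have h3 := Nat.mod_lt m (show 12 * c > 0 by omega)
  have h4 := Nat.mod_lt (m % (12 * c)) (show 2 * c > 0 by omega)
  have hb : m % (12 * c) / (2 * c) < 6 := Nat.div_lt_of_lt_mul (by omega)
  have he : m = 12 * (c * (m / (12 * c))) + 2 * (c * (m % (12 * c) / (2 * c))) +
      m % (12 * c) % (2 * c) := by
    rw [mul_assoc] at h1 h2
    omega
  refine ⟨_, _, _, hb, h4, he, ?_⟩
  conv_lhs => rw [he]
  exact cutNim_eq hc hb h4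

/-- The values `x`, up to a parity twist, that positions with total block index `q` can produce. -/
def IsLowSum : ℕ → ℕ → Prop
  | 0, x => x = 0
  | 1, x => x = 0 ∨ x = 2
  | 2, x => x = 0 ∨ x = 2 ∨ x = 1 ∨ x = 5
  | 3, x => x ≠ 4 ∧ x ≠ 6
  | _, x => x ≠ 6

instance : ∀ q x, Decidable (IsLowSum q x)
  | 0, x => inferInstanceAs (Decidable (x = 0))
  | 1, x => inferInstanceAs (Decidable (x = 0 ∨ x = 2))
  | 2, x => inferInstanceAs (Decidable (x = 0 ∨ x = 2 ∨ x = 1 ∨ x = 5))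
  | 3, x => inferInstanceAs (Decidable (x ≠ 4 ∧ x ≠ 6))
  | _ + 4, x => inferInstanceAs (Decidable (x ≠ 6))

set_option synthInstance.maxSize 4096 in
set_option synthInstance.maxHeartbeats 400000 in
theorem isLowSum_step : ∀ q < 5, ∀ b < 5, ∀ d < 2, q + b + d < 5 → ∀ j < 3, ∀ s < 2, ∀ x < 8,
    IsLowSum q (x ^^^ s) → IsLowSum (q + b + d) ((lowNim b j ^^^ x) ^^^ ((j + s) % 2)) := by
  decide +kernel

set_option synthInstance.maxSize 4096 in
set_option synthInstance.maxHeartbeats 400000 in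
theorem not_isLowSum : ∀ b < 5, ∀ j < 3, ¬ IsLowSum b (lowNim (b + 1) j ^^^ (j % 2)) := by
  decide +kernel

set_option synthInstance.maxSize 4096 in
set_option synthInstance.maxHeartbeats 400000 in
theorem pair_ne : ∀ b < 6, ∀ b' < 6, b + b' < 6 → ∀ j < 3, ∀ j' < 3, ∀ r < 3, r ≠ 0 →
    (j + j' + 1) % 2 = r % 2 → lowNim b j ^^^ lowNim b' j' ≠ lowNim (b + b') r := by
  decide +kernel

set_option synthInstance.maxSize 4096 in
set_option synthInstance.maxHeartbeats 400000 in
theorem pair_ne_carry : ∀ b < 6, ∀ b' < 6, b + b' + 1 < 6 → ∀ j < 3, ∀ j' < 3, ∀ r < 3,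
    (j + j' + 1) % 2 = r % 2 → (j = 0 → r = 0) → (j' = 0 → r = 0) →
    lowNim b j ^^^ lowNim b' j' ≠ lowNim (b + b' + 1) r := by
  decide +kernel

/-- The nim-value (mod 8) of a stuck position of type `t`: the last position of block `t < 6`,
or the first position of block `2` when `t = 6`. -/
def stuckNim (t : ℕ) : ℕ := if t = 6 then 1 else lowNim t 1

/-- The block containing the successor, or for `t = 6` the block itself. -/
def stuckBlock (t : ℕ) : ℕ := if t = 6 then 2 else t + 1

/-- Whether a stuck type is the one at the start of a block. -/
def isStart (t : ℕ) : ℕ := if t = 6 then 1 else 0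

/-- The number of block lengths absorbed by the offsets `offs n`. -/
def carryOf : ℕ → ℕ
  | 0 => 1
  | 1 => 2
  | 2 => 1
  | _ => 0

/-- Offset representatives of the triple replacing three stuck positions, `n` of which are at the
start of a block. -/
def offs : ℕ → ℕ × ℕ × ℕ
  | 0 => (0, 1, 1)
  | 1 => (2, 1, 2)
  | 2 => (1, 2, 1)
  | _ => (0, 0, 1)

/-- The triples of stuck types (encoded by their multiplicities as decimal digits) that are not
handled by `exists_blocks`. -/
def Exceptional (t₁ t₂ t₃ : ℕ) : Prop :=
  10 ^ t₁ + 10 ^ t₂ + 10 ^ t₃ ∈ [1000002, 111, 110100, 1020000]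

instance (t₁ t₂ t₃ : ℕ) : Decidable (Exceptional t₁ t₂ t₃) := by
  unfold Exceptional; infer_instance

set_option synthInstance.maxSize 4096 in
set_option synthInstance.maxHeartbeats 400000 in
theorem exists_not_exceptional : ∀ t₁ < 7, ∀ t₂ < 7, ∀ t₃ < 7, ∀ t₄ < 7,
    ¬ Exceptional t₁ t₂ t₃ ∨ ¬ Exceptional t₁ t₂ t₄ ∨ ¬ Exceptional t₁ t₃ t₄ ∨
      ¬ Exceptional t₂ t₃ t₄ := by
  decide +kernel

set_option synthInstance.maxSize 4096 in
set_option synthInstance.maxHeartbeats 400000 in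
theorem exists_blocks : ∀ t₁ < 7, ∀ t₂ < 7, ∀ t₃ < 7, ¬ Exceptional t₁ t₂ t₃ →
    ∃ e < 2, ∃ a₁ < 6, ∃ a₂ < 6, ∃ a₃ < 6,
      stuckBlock t₁ + stuckBlock t₂ + stuckBlock t₃ =
        a₁ + a₂ + a₃ + carryOf (isStart t₁ + isStart t₂ + isStart t₃) + 12 * e ∧
      lowNim a₁ (offs (isStart t₁ + isStart t₂ + isStart t₃)).1 ^^^
        (lowNim a₂ (offs (isStart t₁ + isStart t₂ + isStart t₃)).2.1 ^^^
        lowNim a₃ (offs (isStart t₁ + isStart t₂ + isStart t₃)).2.2) =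
      (stuckNim t₁ ^^^ (stuckNim t₂ ^^^ stuckNim t₃)) ^^^ 1 := by
  decide +kernel

/-- The nim-sum of the values `cutNim c x` over a list. -/
def xorSum (c : ℕ) (l : List ℕ) : ℕ := (l.map (cutNim c)).foldr (· ^^^ ·) 0

@[simp] theorem xorSum_nil (c : ℕ) : xorSum c [] = 0 := rfl

@[simp] theorem xorSum_cons (c x : ℕ) (l : List ℕ) :
    xorSum c (x :: l) = cutNim c x ^^^ xorSum c l := rfl

theorem xorSum_perm (c : ℕ) {l l' : List ℕ} (h : l.Perm l') : xorSum c l = xorSum c l' :=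
  (h.map _).foldr_op_eq

/-- A list can be replaced by one of the same length, sum larger by one and value XORed with `1`. -/
def Steps (c : ℕ) (l : List ℕ) : Prop :=
  ∃ l' : List ℕ, l'.length = l.length ∧ l'.sum = l.sum + 1 ∧ xorSum c l' = xorSum c l ^^^ 1

theorem Steps.cons {c : ℕ} {l : List ℕ} (h : Steps c l) (x : ℕ) : Steps c (x :: l) := by
  obtain ⟨l', h1, h2, h3⟩ := h
  refine ⟨x :: l', by simp [h1], by simp [h2]; omega, by simp [h3, Nat.xor_assoc]⟩

theorem Steps.perm {c : ℕ} {l l' : List ℕ} (h : Steps c l) (hp : l.Perm l') : Steps c l' := by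
  obtain ⟨m, h1, h2, h3⟩ := h
  exact ⟨m, by rw [h1, hp.length_eq], by rw [h2, hp.sum_eq], by rw [h3, xorSum_perm c hp]⟩

theorem Steps.append {c : ℕ} {l : List ℕ} (h : Steps c l) (r : List ℕ) : Steps c (l ++ r) := by
  induction r with
  | nil => simpa using h
  | cons x r ih => exact (ih.cons x).perm List.perm_middle.symm

/-- The position `x`, in period `k`, is stuck of type `t`: its successor need not have value
`cutNim c x ^^^ 1`. -/
def Stuck (c x k t : ℕ) : Prop :=
  t < 7 ∧ x + 1 = 12 * (c * k) + 2 * (c * stuckBlock t) + isStart t ∧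
    cutNim c x = 8 * k + stuckNim t

theorem cutNim_succ_or_stuck {c : ℕ} (hc : 0 < c) (x : ℕ) :
    cutNim c (x + 1) = cutNim c x ^^^ 1 ∨ ∃ k t, Stuck c x k t := by
  obtain ⟨k, b, i, hb, hi, hx, hv⟩ := exists_block hc x
  by_cases hend : i + 1 = 2 * c
  · refine Or.inr ⟨k, b, by omega, ?_, ?_⟩
    · have : c * (b + 1) = c * b + c := by ring
      simp only [stuckBlock, isStart, show b ≠ 6 by omega, if_false, this]
      omega
    · rw [hv, stuckNim, if_neg (by omega), ← lowNim_offRep b i]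
      congr 2
      unfold offRep; split_ifs <;> omega
  by_cases hs : b = 2 ∧ i = 0
  · obtain ⟨rfl, rfl⟩ := hs
    exact Or.inr ⟨k, 6, by omega, by simp [stuckBlock, isStart]; omega, hv⟩
  · left
    have e : x + 1 = 12 * (c * k) + 2 * (c * b) + (i + 1) := by omega
    have h1 : (1 : ℕ) = 8 * 0 + 1 := rfl
    rw [hv, e, cutNim_eq hc hb (by omega)]
    conv_rhs => rw [h1]
    rw [xor_eight_mul_add (lowNim_lt _ _) (by omega), Nat.xor_zero]
    congr 1
    have key : ∀ b < 6, ∀ j < 3, ¬ (b = 2 ∧ j = 0) →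
        lowNim b (2 - (j + 1) % 2) = lowNim b j ^^^ 1 := by decide +kernel
    rw [← lowNim_offRep b (i + 1), ← lowNim_offRep b i, ← key b hb _ (offRep_lt i)
      (by rwa [offRep_eq_zero])]
    have := offRep_mod i
    congr 1
    rw [offRep, if_neg (by omega)]
    omega

theorem exists_offs {c : ℕ} (hc : 2 ≤ c) (b₁ b₂ b₃ : ℕ) : ∀ n < 4,
    ∃ i₁ i₂ i₃, i₁ < 2 * c ∧ i₂ < 2 * c ∧ i₃ < 2 * c ∧
      i₁ + i₂ + i₃ + 2 = 2 * (c * carryOf n) + n ∧ lowNim b₁ i₁ = lowNim b₁ (offs n).1 ∧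
      lowNim b₂ i₂ = lowNim b₂ (offs n).2.1 ∧ lowNim b₃ i₃ = lowNim b₃ (offs n).2.2 := by
  have even (b : ℕ) : lowNim b (2 * c - 2) = lowNim b 2 := by
    rw [← lowNim_offRep b (2 * c - 2)]
    congr 1
    unfold offRep; split_ifs <;> omega
  have odd₁ (b : ℕ) : lowNim b (2 * c - 1) = lowNim b 1 := by
    rw [← lowNim_offRep b (2 * c - 1)]
    congr 1
    unfold offRep; split_ifs <;> omega
  have odd₃ (b : ℕ) : lowNim b (2 * c - 3) = lowNim b 1 := by
    rw [← lowNim_offRep b (2 * c - 3)]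
    congr 1
    unfold offRep; split_ifs <;> omega
  intro n hn
  interval_cases n
  · exact ⟨0, 1, 2 * c - 3, by omega, by omega, by omega, by simp only [carryOf]; omega,
      rfl, rfl, odd₃ _⟩
  · exact ⟨2, 2 * c - 1, 2 * c - 2, by omega, by omega, by omega, by simp only [carryOf]; omega,
      rfl, odd₁ _, even _⟩
  · exact ⟨1, 2, 2 * c - 3, by omega, by omega, by omega, by simp only [carryOf]; omega,
      rfl, rfl, odd₃ _⟩
  · exact ⟨0, 0, 1, by omega, by omega, by omega, by simp only [carryOf]; omega, rfl, rfl, rfl⟩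

theorem xor_three_eight {k₁ l₁ k₂ l₂ k₃ l₃ : ℕ} (h₁ : l₁ < 8) (h₂ : l₂ < 8) (h₃ : l₃ < 8) :
    (8 * k₁ + l₁) ^^^ ((8 * k₂ + l₂) ^^^ (8 * k₃ + l₃)) =
      8 * (k₁ ^^^ (k₂ ^^^ k₃)) + (l₁ ^^^ (l₂ ^^^ l₃)) := by
  rw [xor_eight_mul_add h₂ h₃, xor_eight_mul_add h₁ (xor_lt_eight h₂ h₃)]

theorem stuckNim_lt (t : ℕ) : stuckNim t < 8 := by
  unfold stuckNim; split_ifs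
  · omega
  · exact lowNim_lt _ _

theorem steps_of_stuck {c : ℕ} (hc : 2 ≤ c) {x₁ x₂ x₃ k₁ k₂ k₃ t₁ t₂ t₃ : ℕ}
    (h₁ : Stuck c x₁ k₁ t₁) (h₂ : Stuck c x₂ k₂ t₂) (h₃ : Stuck c x₃ k₃ t₃)
    (h : ¬ Exceptional t₁ t₂ t₃) : Steps c [x₁, x₂, x₃] := by
  obtain ⟨ht₁, hx₁, hv₁⟩ := h₁
  obtain ⟨ht₂, hx₂, hv₂⟩ := h₂
  obtain ⟨ht₃, hx₃, hv₃⟩ := h₃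
  obtain ⟨e, -, b₁, hb₁, b₂, hb₂, b₃, hb₃, hsum, hxor⟩ :=
    exists_blocks t₁ ht₁ t₂ ht₂ t₃ ht₃ h
  have hs (t : ℕ) : isStart t ≤ 1 := by unfold isStart; split_ifs <;> omega
  have hn : isStart t₁ + isStart t₂ + isStart t₃ < 4 := by
    have := hs t₁; have := hs t₂; have := hs t₃; omega
  obtain ⟨i₁, i₂, i₃, hi₁, hi₂, hi₃, hi, e₁, e₂, e₃⟩ := exists_offs hc b₁ b₂ b₃ _ hn
  obtain ⟨u, hu⟩ := exists_add_eq_xor_add_two_mul k₂ k₃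
  obtain ⟨w, hw⟩ := exists_add_eq_xor_add_two_mul k₁ (k₂ ^^^ k₃)
  have hc0 : 0 < c := by omega
  refine ⟨[12 * (c * (k₁ ^^^ (k₂ ^^^ k₃))) + 2 * (c * b₁) + i₁,
    12 * (c * (u + w + e)) + 2 * (c * b₂) + i₂,
    12 * (c * (u + w + e)) + 2 * (c * b₃) + i₃], rfl, ?_, ?_⟩
  · simp only [List.sum_cons, List.sum_nil]
    have hk : k₁ + k₂ + k₃ = (k₁ ^^^ (k₂ ^^^ k₃)) + 2 * (u + w) := by omega
    generalize (k₁ ^^^ (k₂ ^^^ k₃)) = z at hk ⊢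
    have hk' := congrArg (c * ·) hk
    have hs' := congrArg (c * ·) hsum
    simp only [mul_add] at hk' hs' ⊢
    have r1 : c * (2 * u) = 2 * (c * u) := by ring
    have r2 : c * (2 * w) = 2 * (c * w) := by ring
    have r3 : c * (12 * e) = 12 * (c * e) := by ring
    omega
  · simp only [xorSum_cons, xorSum_nil, Nat.xor_zero, cutNim_eq hc0 hb₁ hi₁,
      cutNim_eq hc0 hb₂ hi₂, cutNim_eq hc0 hb₃ hi₃, hv₁, hv₂, hv₃]
    rw [xor_three_eight (lowNim_lt _ _) (lowNim_lt _ _) (lowNim_lt _ _),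
      xor_three_eight (stuckNim_lt _) (stuckNim_lt _) (stuckNim_lt _), e₁, e₂, e₃, hxor,
      Nat.xor_self, Nat.xor_zero]
    have h1 : (1 : ℕ) = 8 * 0 + 1 := rfl
    conv_rhs => rw [h1]
    rw [xor_eight_mul_add (xor_lt_eight (stuckNim_lt _) (xor_lt_eight (stuckNim_lt _)
      (stuckNim_lt _))) (by omega), Nat.xor_zero]

theorem steps_singleton {c x : ℕ} (h : cutNim c (x + 1) = cutNim c x ^^^ 1) : Steps c [x] :=
  ⟨[x + 1], rfl, by simp, by simpa using h⟩

theorem steps_of_four_le {c : ℕ} (hc : 2 ≤ c) (l : List ℕ) (hl : 4 ≤ l.length) :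
    Steps c l := by
  obtain ⟨x₁, x₂, x₃, x₄, r, rfl⟩ : ∃ x₁ x₂ x₃ x₄ r, l = x₁ :: x₂ :: x₃ :: x₄ :: r := by
    match l, hl with
    | x₁ :: x₂ :: x₃ :: x₄ :: r, _ => exact ⟨_, _, _, _, _, rfl⟩
  suffices h : Steps c [x₁, x₂, x₃, x₄] from h.append r
  have hc0 : 0 < c := by omega
  rcases cutNim_succ_or_stuck hc0 x₁ with h | ⟨k₁, t₁, h₁⟩
  · exact (steps_singleton h).append [x₂, x₃, x₄]
  rcases cutNim_succ_or_stuck hc0 x₂ with h | ⟨k₂, t₂, h₂⟩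
  · exact ((steps_singleton h).append [x₃, x₄]).cons x₁
  rcases cutNim_succ_or_stuck hc0 x₃ with h | ⟨k₃, t₃, h₃⟩
  · exact (((steps_singleton h).append [x₄]).cons x₂).cons x₁
  rcases cutNim_succ_or_stuck hc0 x₄ with h | ⟨k₄, t₄, h₄⟩
  · exact (((steps_singleton h).cons x₃).cons x₂).cons x₁
  rcases exists_not_exceptional t₁ h₁.1 t₂ h₂.1 t₃ h₃.1 t₄ h₄.1 with h | h | h | h
  · exact (steps_of_stuck hc h₁ h₂ h₃ h).append [x₄]
  · exact ((steps_of_stuck hc h₁ h₂ h₄ h).append [x₃]).perm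
      (((List.Perm.swap x₃ x₄ []).cons x₂).cons x₁)
  · exact ((steps_of_stuck hc h₁ h₃ h₄ h).cons x₂).perm (List.Perm.swap x₁ x₂ _)
  · exact (steps_of_stuck hc h₂ h₃ h₄ h).cons x₁

/-- The nim-set of `p` heaps, with one subtracted from each heap. -/
def offsetSet (c p s : ℕ) : Set ℕ :=
  {v | ∃ l : List ℕ, l.length = p ∧ l.sum = s ∧ xorSum c l = v}

theorem offsetSet_step {c p s v : ℕ} (hc : 2 ≤ c) (hp : 4 ≤ p) (hv : v ∈ offsetSet c p s) :
    v ^^^ 1 ∈ offsetSet c p (s + 1) := by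
  obtain ⟨l, rfl, rfl, rfl⟩ := hv
  exact steps_of_four_le hc l hp

theorem offsetSet_add {c p s v : ℕ} (hc : 2 ≤ c) (hp : 4 ≤ p) (hv : v ∈ offsetSet c p s)
    (j : ℕ) : v ^^^ (j % 2) ∈ offsetSet c p (s + j) := by
  induction j with
  | zero => simpa using hv
  | succ j ih =>
    have h := offsetSet_step hc hp ih
    rw [Nat.xor_assoc] at h
    have e : (j % 2) ^^^ 1 = (j + 1) % 2 := by
      rcases Nat.mod_two_eq_zero_or_one j with h | h
      · rw [h, show (j + 1) % 2 = 1 by omega, Nat.zero_xor]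
      · rw [h, show (j + 1) % 2 = 0 by omega, Nat.xor_self]
    rwa [e] at h

theorem cutNim_zero (c : ℕ) : cutNim c 0 = 0 := by simp [cutNim, lowNim]

theorem xorSum_replicate_zero (c n : ℕ) : xorSum c (List.replicate n 0) = 0 := by
  induction n with
  | zero => rfl
  | succ n ih => simp [List.replicate_succ, cutNim_zero, ih]

theorem xor_mem_offsetSet {c p : ℕ} (hp : 2 ≤ p) (x y : ℕ) :
    cutNim c x ^^^ cutNim c y ∈ offsetSet c p (x + y) :=
  ⟨x :: y :: List.replicate (p - 2) 0, by simp; omega, by simp,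
    by simp [xorSum_replicate_zero]⟩

theorem cutNim_mem_offsetSet {c p : ℕ} (hp : 2 ≤ p) (x : ℕ) :
    cutNim c x ∈ offsetSet c p x := by
  simpa [cutNim_zero] using xor_mem_offsetSet (c := c) hp x 0

theorem cutNim_pair_ne {c : ℕ} (hc : 0 < c) (x y : ℕ) :
    cutNim c x ^^^ cutNim c y ≠ cutNim c (x + y + 1) := by
  obtain ⟨k, b, i, hb, hi, hx, hvx⟩ := exists_block hc x
  obtain ⟨k', b', i', hb', hi', hy, hvy⟩ := exists_block hc y
  obtain ⟨K, B, r, hB, hr, hm, hvm⟩ := exists_block hc (x + y + 1)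
  rw [hvx, hvy, hvm, xor_eight_mul_add (lowNim_lt _ _) (lowNim_lt _ _)]
  intro h
  have hX := xor_lt_eight (lowNim_lt b i) (lowNim_lt b' i')
  have hL := lowNim_lt B r
  have hK : k ^^^ k' = K := by omega
  have hl : lowNim b i ^^^ lowNim b' i' = lowNim B r := by omega
  obtain ⟨t, ht⟩ := exists_add_eq_xor_add_two_mul k k'
  have hkK : k + k' = K := by
    by_contra hne
    have h1 : K + 1 ≤ k + k' := by omega
    have h2 := Nat.mul_le_mul_left c h1
    have h3 : c * (B + 1) ≤ c * 6 := Nat.mul_le_mul_left c (by omega)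
    simp only [mul_add] at h2 h3
    omega
  subst hkK
  rw [mul_add] at hm
  rw [← lowNim_offRep b i, ← lowNim_offRep b' i', ← lowNim_offRep B r] at hl
  have hi0 := offRep_eq_zero i
  have hi0' := offRep_eq_zero i'
  have hr0 := offRep_eq_zero r
  have hi2 := offRep_mod i
  have hi2' := offRep_mod i'
  have hr2 := offRep_mod r
  rcases lt_trichotomy (b + b') B with hlt | heq | hgt
  · have hB' : B = b + b' + 1 := by
      by_contra hne
      have h2 : c * (b + b' + 2) ≤ c * B := Nat.mul_le_mul_left c (by omega)
      simp only [mul_add] at h2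
      omega
    subst hB'
    simp only [mul_add, mul_one] at hm
    exact pair_ne_carry b hb b' hb' hB _ (offRep_lt i) _ (offRep_lt i') _ (offRep_lt r)
      (by omega) (by omega) (by omega) hl
  · subst heq
    simp only [mul_add] at hm
    exact pair_ne b hb b' hb' hB _ (offRep_lt i) _ (offRep_lt i') _ (offRep_lt r)
      (by omega) (by omega) hl
  · have h2 : c * (B + 1) ≤ c * (b + b') := Nat.mul_le_mul_left c (by omega)
    simp only [mul_add] at h2
    omega

theorem exists_isLowSum {c : ℕ} (hc : 0 < c) (l : List ℕ) :
    ∃ k k' s x, k' ≤ k ∧ x < 8 ∧ l.sum = 12 * (c * k) + s ∧ xorSum c l = 8 * k' + x ∧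
      ∀ q r, q < 5 → r < 2 * c → s = 2 * (c * q) + r → IsLowSum q (x ^^^ (r % 2)) := by
  induction l with
  | nil =>
    refine ⟨0, 0, 0, 0, le_rfl, by omega, by simp, by simp, ?_⟩
    intro q r hq hr h
    obtain rfl : r = 0 := by omega
    have : ∀ q < 5, IsLowSum q 0 := by decide +kernel
    exact this q hq
  | cons y l ih =>
    obtain ⟨k, k', s, x, hk, hx, hs, hX, hW⟩ := ih
    obtain ⟨k₀, b, i, hb, hi, hy, hv⟩ := exists_block hc y
    obtain ⟨t, ht⟩ := exists_add_eq_xor_add_two_mul k₀ k'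
    refine ⟨k₀ + k, k₀ ^^^ k', 2 * (c * b) + i + s, lowNim b i ^^^ x, by omega,
      xor_lt_eight (lowNim_lt _ _) hx, ?_, ?_, ?_⟩
    · rw [List.sum_cons, hs, hy, mul_add]; omega
    · rw [xorSum_cons, hX, hv, xor_eight_mul_add (lowNim_lt _ _) hx]
    intro q' r' hq' hr' h'
    obtain ⟨q, r, hr, hqr⟩ : ∃ q r, r < 2 * c ∧ s = 2 * (c * q) + r :=
      ⟨s / (2 * c), s % (2 * c), Nat.mod_lt _ (by omega), by
        rw [← mul_assoc]; exact (Nat.div_add_mod _ _).symm⟩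
    obtain ⟨d, hd, hq⟩ : ∃ d < 2, q' = q + b + d ∧ i + r = 2 * (c * d) + r' := by
      by_cases hcar : i + r < 2 * c
      · refine ⟨0, by omega, ?_⟩
        have : q' = q + b := by
          rcases lt_trichotomy q' (q + b) with h | h | h
          · have h2 := Nat.mul_le_mul_left c (show q' + 1 ≤ q + b from h)
            simp only [mul_add] at h2
            omega
          · exact h
          · have h2 := Nat.mul_le_mul_left c (show q + b + 1 ≤ q' from h)
            simp only [mul_add] at h2
            omega
        subst this
        rw [mul_add] at h'
        exact ⟨rfl, by omega⟩
      · refine ⟨1, by omega, ?_⟩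
        have : q' = q + b + 1 := by
          rcases lt_trichotomy q' (q + b + 1) with h | h | h
          · have h2 := Nat.mul_le_mul_left c (show q' + 1 ≤ q + b + 1 from h)
            simp only [mul_add] at h2
            omega
          · exact h
          · have h2 := Nat.mul_le_mul_left c (show q + b + 1 + 1 ≤ q' from h)
            simp only [mul_add] at h2
            omega
        subst this
        simp only [mul_add] at h'
        exact ⟨rfl, by omega⟩
    obtain ⟨rfl, hir⟩ := hq
    have hstep := isLowSum_step q (by omega) b (by omega) d hd hq' (offRep i) (offRep_lt i)
      (r % 2) (by omega) x hx (hW q r (by omega) hr hqr)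
    have hi2 := offRep_mod i
    rw [lowNim_offRep, show (offRep i + r % 2) % 2 = r' % 2 by omega] at hstep
    exact hstep

theorem ne_cutNim_of_mem_offsetSet {c p s v : ℕ} (hc : 0 < c) (hv : v ∈ offsetSet c p s) :
    v ≠ cutNim c (s + 2 * c) := by
  obtain ⟨l, -, rfl, rfl⟩ := hv
  obtain ⟨k, k', s, x, hk, hx, hs, hX, hW⟩ := exists_isLowSum hc l
  obtain ⟨K, B, r, hB, hr, hm, hvm⟩ := exists_block hc (l.sum + 2 * c)
  rw [hX, hvm]
  intro h
  have hL := lowNim_lt B r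
  obtain rfl : k' = K := by omega
  obtain rfl : x = lowNim B r := by omega
  have h3 : c * (B + 1) ≤ c * 6 := Nat.mul_le_mul_left c (by omega)
  obtain rfl : k = k' := by
    by_contra hne
    have h2 := Nat.mul_le_mul_left c (show k' + 1 ≤ k by omega)
    simp only [mul_add] at h2 h3
    omega
  obtain ⟨q, rfl⟩ : ∃ q, B = q + 1 := by
    rcases Nat.eq_zero_or_pos B with rfl | hpos
    · omega
    · exact ⟨B - 1, by omega⟩
  rw [mul_add] at hm
  have := hW q r (by omega) hr (by omega)
  rw [← lowNim_offRep, ← offRep_mod] at this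
  exact not_isLowSum q (by omega) _ (offRep_lt r) this

theorem mem_offsetSet_of_le {c p K l₀ s₀ l s : ℕ} (hc : 2 ≤ c) (hp : 4 ≤ p) (hl₀ : l₀ < 8)
    (h : 8 * K + l₀ ∈ offsetSet c p (12 * (c * K) + s₀)) (hs : s₀ ≤ s)
    (hl : l = l₀ ^^^ ((s - s₀) % 2)) : 8 * K + l ∈ offsetSet c p (12 * (c * K) + s) := by
  have := offsetSet_add hc hp h (s - s₀)
  have h1 : (s - s₀) % 2 = 8 * 0 + (s - s₀) % 2 := by omega
  rw [h1, xor_eight_mul_add hl₀ (by omega), Nat.xor_zero, ← hl] at this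
  rwa [show 12 * (c * K) + s₀ + (s - s₀) = 12 * (c * K) + s by omega] at this

theorem mem_offsetSet {c p K l s : ℕ} (hc : 2 ≤ c) (hp : 4 ≤ p) (hl : l < 8)
    (h : l = s % 2 ∨ (2 * c ≤ s ∧ l = 2 + s % 2) ∨ (4 * c ≤ s ∧ l < 2) ∨
      (4 * c < s ∧ l = 4 + (s + 1) % 2) ∨ (6 * c ≤ s ∧ l < 4) ∨
      (6 * c < s ∧ l = 6 + (s + 1) % 2) ∨ (8 * c ≤ s ∧ l < 6) ∨ 10 * c ≤ s) :
    8 * K + l ∈ offsetSet c p (12 * (c * K) + s) := by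
  have hc0 : 0 < c := by omega
  have single {b i : ℕ} (hb : b < 6) (hi : i < 2 * c) : 8 * K + lowNim b i ∈
      offsetSet c p (12 * (c * K) + (2 * (c * b) + i)) := by
    rw [← cutNim_eq hc0 hb hi, ← add_assoc]
    exact cutNim_mem_offsetSet (by omega) _
  have s0 : 8 * K + 0 ∈ offsetSet c p (12 * (c * K) + (2 * (c * 0) + 0)) :=
    single (b := 0) (i := 0) (by omega) (by omega)
  have s1 : 8 * K + 2 ∈ offsetSet c p (12 * (c * K) + (2 * (c * 1) + 0)) :=
    single (b := 1) (i := 0) (by omega) (by omega)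
  have s2 : 8 * K + 1 ∈ offsetSet c p (12 * (c * K) + (2 * (c * 2) + 0)) :=
    single (b := 2) (i := 0) (by omega) (by omega)
  have s2' : 8 * K + 4 ∈ offsetSet c p (12 * (c * K) + (2 * (c * 2) + 1)) :=
    single (b := 2) (i := 1) (by omega) (by omega)
  have s3 : 8 * K + 3 ∈ offsetSet c p (12 * (c * K) + (2 * (c * 3) + 0)) :=
    single (b := 3) (i := 0) (by omega) (by omega)
  have s4 : 8 * K + 4 ∈ offsetSet c p (12 * (c * K) + (2 * (c * 4) + 0)) :=
    single (b := 4) (i := 0) (by omega) (by omega)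
  have s5 : 8 * K + 6 ∈ offsetSet c p (12 * (c * K) + (2 * (c * 5) + 0)) :=
    single (b := 5) (i := 0) (by omega) (by omega)
  have s21 : 8 * K + 6 ∈ offsetSet c p (12 * (c * K) + (6 * c + 1)) := by
    have h1 := cutNim_eq hc0 (k := K) (b := 2) (i := 1) (by omega) (by omega)
    have h2 := cutNim_eq hc0 (k := 0) (b := 1) (i := 0) (by omega) (by omega)
    have := xor_mem_offsetSet (c := c) (p := p) (by omega)
      (12 * (c * K) + 2 * (c * 2) + 1) (12 * (c * 0) + 2 * (c * 1) + 0)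
    rw [h1, h2, xor_eight_mul_add (lowNim_lt _ _) (lowNim_lt _ _), Nat.xor_zero] at this
    rw [show 12 * (c * K) + (6 * c + 1) =
      12 * (c * K) + 2 * (c * 2) + 1 + (12 * (c * 0) + 2 * (c * 1) + 0) by omega]
    exact this
  have xor_bit : ∀ l < 8, ∀ e < 2, l ^^^ e = if e = 0 then l else l + 1 - 2 * (l % 2) := by
    decide +kernel
  have up {l₀ s₀ : ℕ} (hl₀ : l₀ < 8)
      (h : 8 * K + l₀ ∈ offsetSet c p (12 * (c * K) + s₀)) (hs : s₀ ≤ s)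
      (hl : (l = l₀ ∧ (s - s₀) % 2 = 0) ∨ (l = l₀ + 1 - 2 * (l₀ % 2) ∧ (s - s₀) % 2 = 1)) :
      8 * K + l ∈ offsetSet c p (12 * (c * K) + s) := by
    refine mem_offsetSet_of_le hc hp hl₀ h hs ?_
    rw [xor_bit l₀ hl₀ _ (by omega)]
    rcases hl with ⟨h1, h2⟩ | ⟨h1, h2⟩ <;> simp [h1, h2]
  have low₂ (h : 4 * c ≤ s) (hl : l < 2) : 8 * K + l ∈ offsetSet c p (12 * (c * K) + s) := by
    by_cases hp : l = s % 2
    · exact up (by omega) s0 (by omega) (by omega)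
    · exact up (by omega) s2 (by omega) (by omega)
  have low₄ (h : 6 * c ≤ s) (hl : l < 4) : 8 * K + l ∈ offsetSet c p (12 * (c * K) + s) := by
    by_cases h2 : l < 2
    · exact low₂ (by omega) h2
    by_cases hp : l = 2 + s % 2
    · exact up (by omega) s1 (by omega) (by omega)
    · exact up (by omega) s3 (by omega) (by omega)
  have low₆ (h : 8 * c ≤ s) (hl : l < 6) : 8 * K + l ∈ offsetSet c p (12 * (c * K) + s) := by
    by_cases h4 : l < 4
    · exact low₄ (by omega) h4
    by_cases hp : l = 4 + (s + 1) % 2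
    · exact up (by omega) s2' (by omega) (by omega)
    · exact up (by omega) s4 (by omega) (by omega)
  rcases h with h | ⟨hs, h⟩ | ⟨hs, h⟩ | ⟨hs, h⟩ | ⟨hs, h⟩ | ⟨hs, h⟩ | ⟨hs, h⟩ | hs
  · exact up (by omega) s0 (by omega) (by omega)
  · exact up (by omega) s1 (by omega) (by omega)
  · exact low₂ hs h
  · exact up (by omega) s2' (by omega) (by omega)
  · exact low₄ hs h
  · exact up (by omega) s21 (by omega) (by omega)
  · exact low₆ hs h
  · by_cases h6 : l < 6
    · exact low₆ (by omega) h6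
    by_cases hp : l = 6 + (s + 1) % 2
    · exact up (by omega) s21 (by omega) (by omega)
    · exact up (by omega) s5 (by omega) (by omega)

theorem cutNim_reach {c m v : ℕ} (hc : 2 ≤ c) (hv : v < cutNim c m) :
    (∃ x y, x + y + 1 = m ∧ cutNim c x ^^^ cutNim c y = v) ∨
      ∃ s, s + 2 * c = m ∧ v ∈ offsetSet c (2 * c + 1) s := by
  have hc0 : 0 < c := by omega
  obtain ⟨K, B, r, hB, hr, hm, hvm⟩ := exists_block hc0 m
  have hL := lowNim_lt B r
  rw [hvm] at hv
  obtain ⟨k, l, hl, rfl⟩ : ∃ k l, l < 8 ∧ v = 8 * k + l :=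
    ⟨v / 8, v % 8, by omega, by omega⟩
  have big {s : ℕ} (hs : 12 * (c * k) + s + 2 * c = m)
      (h : l = s % 2 ∨ (2 * c ≤ s ∧ l = 2 + s % 2) ∨ (4 * c ≤ s ∧ l < 2) ∨
        (4 * c < s ∧ l = 4 + (s + 1) % 2) ∨ (6 * c ≤ s ∧ l < 4) ∨
        (6 * c < s ∧ l = 6 + (s + 1) % 2) ∨ (8 * c ≤ s ∧ l < 6) ∨ 10 * c ≤ s) :
      (∃ x y, x + y + 1 = m ∧ cutNim c x ^^^ cutNim c y = 8 * k + l) ∨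
        ∃ s, s + 2 * c = m ∧ 8 * k + l ∈ offsetSet c (2 * c + 1) s :=
    Or.inr ⟨_, hs, mem_offsetSet hc (by omega) hl h⟩
  rcases Nat.lt_or_ge k K with hk | hk
  · have h2 := Nat.mul_le_mul_left c (show k + 1 ≤ K from hk)
    rw [mul_add, mul_one] at h2
    exact big (s := m - 2 * c - 12 * (c * k)) (by omega) (by omega)
  obtain rfl : k = K := by omega
  have hlt : l < lowNim B r := by omega
  have pair {b i b' i' : ℕ} (hb : b < 6) (hi : i < 2 * c) (hb' : b' < 6) (hi' : i' < 2 * c)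
      (hs : 2 * (c * b) + i + (2 * (c * b') + i') + 1 = 2 * (c * B) + r)
      (h : lowNim b (offRep i) ^^^ lowNim b' (offRep i') = l) :
      (∃ x y, x + y + 1 = m ∧ cutNim c x ^^^ cutNim c y = 8 * k + l) ∨
        ∃ s, s + 2 * c = m ∧ 8 * k + l ∈ offsetSet c (2 * c + 1) s := by
    rw [lowNim_offRep, lowNim_offRep] at h
    refine Or.inl ⟨12 * (c * k) + 2 * (c * b) + i, 12 * (c * 0) + 2 * (c * b') + i', by omega, ?_⟩
    rw [cutNim_eq hc0 hb hi, cutNim_eq hc0 hb' hi',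
      xor_eight_mul_add (lowNim_lt _ _) (lowNim_lt _ _), Nat.xor_zero, h]
  have rep_odd {i : ℕ} (h : i % 2 = 1) : offRep i = 1 := by
    unfold offRep; split_ifs <;> omega
  have rep_even {i : ℕ} (h : i % 2 = 0) (h0 : i ≠ 0) : offRep i = 2 := by
    unfold offRep; split_ifs <;> omega
  have even_zero {b i : ℕ} (hb : b < 2) (h : i % 2 = 0) :
      lowNim b (offRep i) = lowNim b 0 := by
    have key : ∀ b < 2, lowNim b 2 = lowNim b 0 := by decide
    by_cases h0 : i = 0
    · subst h0; rfl
    · rw [rep_even h h0, key b hb]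
  interval_cases B
  · simp [lowNim] at hlt
    refine pair (b := 0) (i := 0) (b' := 0) (i' := r - 1) (by omega) (by omega) (by omega)
      (by omega) (by omega) ?_
    rw [even_zero (by omega) (by omega), even_zero (by omega) (by omega)]
    simp [lowNim]
    omega
  · simp [lowNim] at hlt
    by_cases h0 : l = r % 2
    · exact big (s := r) (by omega) (by omega)
    by_cases h1 : l < 2
    · refine pair (b := 0) (i := r) (b' := 0) (i' := 2 * c - 1) (by omega) (by omega) (by omega)
        (by omega) (by omega) ?_
      rw [rep_odd (i := 2 * c - 1) (by omega), lowNim_offRep]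
      rcases Nat.mod_two_eq_zero_or_one r with h | h
      · simp [lowNim, h]; omega
      · simp [lowNim, h]; omega
    · refine pair (b := 1) (i := 0) (b' := 0) (i' := r - 1) (by omega) (by omega) (by omega)
        (by omega) (by omega) ?_
      rw [even_zero (by omega) (by omega), even_zero (by omega) (by omega)]
      simp [lowNim]
      omega
  · by_cases hr0 : r = 0
    · subst hr0
      simp [lowNim] at hlt
      exact big (s := 2 * c) (by omega) (by omega)
    simp [lowNim, hr0] at hlt
    by_cases h0 : l = r % 2 ∨ l = 2 + r % 2
    · exact big (s := 2 * c + r) (by omega) (by omega)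
    by_cases h1 : l < 2
    · refine pair (b := 1) (i := 0) (b' := 1) (i' := r - 1) (by omega) (by omega) (by omega)
        (by omega) (by omega) ?_
      rw [even_zero (by omega) (by omega), lowNim_offRep]
      rcases Nat.mod_two_eq_zero_or_one r with h | h
      · simp [lowNim, show (r - 1) % 2 = 1 by omega]; omega
      · simp [lowNim, show (r - 1) % 2 = 0 by omega]; omega
    by_cases h2 : l < 4
    · refine pair (b := 1) (i := 2 * c - 1) (b' := 0) (i' := r) (by omega) (by omega) (by omega)
        (by omega) (by omega) ?_
      rw [rep_odd (i := 2 * c - 1) (by omega), lowNim_offRep]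
      rcases Nat.mod_two_eq_zero_or_one r with h | h
      · simp [lowNim, h]; omega
      · simp [lowNim, h]; omega
    · refine pair (b := 2) (i := 1) (b' := 0) (i' := r - 2) (by omega) (by omega) (by omega)
        (by omega) (by omega) ?_
      rw [even_zero (b := 0) (by omega) (by omega), rep_odd (i := 1) rfl]
      simp [lowNim]
      omega
  · simp [lowNim] at hlt
    exact big (s := 4 * c + r) (by omega) (by omega)
  · simp [lowNim] at hlt
    exact big (s := 6 * c + r) (by omega) (by omega)
  · simp [lowNim] at hlt
    exact big (s := 8 * c + r) (by omega) (by omega)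

theorem map_succ_sum (l : List ℕ) : (l.map (· + 1)).sum = l.sum + l.length := by
  induction l with
  | nil => rfl
  | cons x l ih => simp only [List.map_cons, List.sum_cons, List.length_cons, ih]; omega

theorem exists_pos_list_iff {c p n v : ℕ} {f : ℕ → ℕ}
    (hf : ∀ x, 0 < x → x + p ≤ n + 1 → f x = cutNim c (x - 1)) :
    (∃ l : List ℕ, l.length = p ∧ (∀ x ∈ l, 0 < x) ∧ l.sum = n ∧
      (l.map f).foldr (· ^^^ ·) 0 = v) ↔ ∃ s, s + p = n ∧ v ∈ offsetSet c p s := by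
  have le_of_mem (l : List ℕ) (x : ℕ) (hx : x ∈ l) : x ≤ l.sum := List.le_sum_of_mem hx
  have key (l : List ℕ) (hl : l.length = p) (hn : l.sum + p = n) :
      ((l.map (· + 1)).map f).foldr (· ^^^ ·) 0 = xorSum c l := by
    rw [List.map_map, xorSum]
    congr 1
    refine List.map_congr_left fun x hx => ?_
    have := le_of_mem l x hx
    simpa using hf (x + 1) (by omega) (by omega)
  constructor
  · rintro ⟨l, hl, hpos, hs, rfl⟩
    have e : l = (l.map (· - 1)).map (· + 1) := by
      rw [List.map_map]
      conv_lhs => rw [← List.map_id l]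
      refine List.map_congr_left fun x hx => ?_
      have := hpos x hx
      simp only [Function.comp, id]
      omega
    have hs' : (l.map (· - 1)).sum + p = n := by
      rw [← hs, ← hl]
      conv_rhs => rw [e, map_succ_sum]
      simp
    refine ⟨_, hs', l.map (· - 1), by simpa using hl, rfl, ?_⟩
    rw [← key _ (by simpa using hl) hs', ← e]
  · rintro ⟨s, hs, l, hl, rfl, rfl⟩
    exact ⟨l.map (· + 1), by simpa using hl, by simp, by rw [map_succ_sum, hl, hs],
      key l hl hs⟩

theorem mex_eq {S : Set ℕ} {v : ℕ} (hv : v ∉ S) (h : ∀ u < v, u ∈ S) : mex S = v :=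
  le_antisymm (Nat.sInf_le hv)
    (le_csInf ⟨v, hv⟩ fun u hu => not_lt.1 fun hlt => hu (h u hlt))

theorem cutGAux_eq {c : ℕ} (hc : 2 ≤ c) (fuel : ℕ) : ∀ n, 0 < n → n ≤ fuel →
    cutGAux {1, 2 * c} fuel n = cutNim c (n - 1) := by
  induction fuel with
  | zero => intro n h0 h1; omega
  | succ fuel ih =>
    intro n h0 hn
    have iff {d v : ℕ} (hd : 0 < d) := exists_pos_list_iff (c := c) (p := d + 1) (n := n) (v := v)
      (f := cutGAux {1, 2 * c} fuel) fun x hx hle => ih x hx (by omega)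
    rw [cutGAux]
    apply mex_eq
    · rintro ⟨d, hd, h⟩
      rw [Finset.mem_insert, Finset.mem_singleton] at hd
      obtain ⟨s, hs, h⟩ := (iff (by omega)).1 h
      rcases hd with rfl | rfl
      · obtain ⟨l, hl, rfl, hx⟩ := h
        obtain ⟨x, y, rfl⟩ := List.length_eq_two.1 hl
        refine cutNim_pair_ne (c := c) (by omega) x y ?_
        simp only [xorSum_cons, xorSum_nil, Nat.xor_zero, List.sum_cons, List.sum_nil] at hx hs
        rw [hx]
        congr 1
        omega
      · refine ne_cutNim_of_mem_offsetSet (by omega) h ?_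
        congr 1
        omega
    · intro u hu
      rcases cutNim_reach hc hu with ⟨x, y, hxy, h⟩ | ⟨s, hs, h⟩
      · exact ⟨1, by simp, (iff (by omega)).2
          ⟨x + y, by omega, [x, y], rfl, by simp, by simpa using h⟩⟩
      · exact ⟨2 * c, by simp, (iff (by omega)).2 ⟨s, by omega, h⟩⟩

theorem mem_nimSet_iff {c : ℕ} (hc : 2 ≤ c) {n p v : ℕ} :
    v ∈ nimSet n p {1, 2 * c} ↔ ∃ s, s + p = n ∧ v ∈ offsetSet c p s :=
  exists_pos_list_iff fun x hx _ => cutGAux_eq hc x x hx le_rfl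

/-- For `p ≥ 4`, once a value appears in the nim-set, its `⊕ 1` companion appears
in the next nim-set. -/
theorem nimSet_step (p : ℕ) (hp : 4 ≤ p) (c : ℕ) (hc : 2 ≤ c)
    (n : ℕ) (hn : p ≤ n) (v : ℕ) (hv : v ∈ nimSet n p {1, 2*c}) :
    v ^^^ 1 ∈ nimSet (n + 1) p {1, 2*c} := by
  obtain ⟨s, hs, h⟩ := (mem_nimSet_iff hc).1 hv
  exact (mem_nimSet_iff hc).2 ⟨s + 1, by omega, offsetSet_step hc hp h⟩
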